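/- In the normalized prime-power setting, there exist an equivalence e between the index types Fin f ⊕ (ZMod (p^N) × Fin r) and (Fin f ⊕ (ZMod (p^{N−1}) × Fin r)) ⊕ ((ZMod (p^N))ˣ × Fin r), and an invertible complex matrix T indexed by Fin f ⊕ (ZMod (p^N) × Fin r), such that T⁻¹ * M * T equals the transport along e of the block matrix whose top-left block is M̃, whose bottom-right block is the block-diagonal matrix with diagonal blocks B_γ for γ ∈ (ZMod (p^N))ˣ, and whose off-diagonal blocks are zero. -/

import Mathlib

open Matrix Polynomial

open scoped Kronecker

/-- A rectangular intertwiner with a left inverse, between index types of equal size,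
is a similarity. -/
lemma exists_isUnit_inv_mul_mul_eq_reindex {I J : Type*} [Fintype I] [DecidableEq I]
    [Fintype J] [DecidableEq J] (e : I ≃ J) {M : Matrix I I ℂ} {X : Matrix J J ℂ}
    {T : Matrix I J ℂ} {S : Matrix J I ℂ} (hST : S * T = 1) (hMT : M * T = T * X) :
    ∃ T' : Matrix I I ℂ, IsUnit T' ∧ T'⁻¹ * M * T' = Matrix.reindex e.symm e.symm X := by
  have hinv : S.submatrix e id * T.submatrix id e = 1 := by
    rw [← Matrix.submatrix_mul S T e id e Function.bijective_id, hST, Matrix.submatrix_one_equiv]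
  have hunit : IsUnit (T.submatrix id e) := IsUnit.of_mul_eq_one_right _ hinv
  refine ⟨T.submatrix id e, hunit, ?_⟩
  have hMT' : M * T.submatrix id e = T.submatrix id e * X.submatrix e e := by
    rw [← Matrix.submatrix_mul T X id e e e.bijective, ← hMT,
      Matrix.submatrix_mul M T id id e Function.bijective_id, Matrix.submatrix_id_id]
  rw [Matrix.mul_assoc, hMT', ← Matrix.mul_assoc,
    Matrix.nonsing_inv_mul _ ((Matrix.isUnit_iff_isUnit_det _).1 hunit), Matrix.one_mul]
  rfl

/-- Block form of an equitable decomposition: `R` collects the orbits, `E` is the complementary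
part of the eigenvector basis. -/
lemma exists_isUnit_inv_mul_fromBlocks_mul_eq_reindex {A P Q U : Type*}
    [Fintype A] [DecidableEq A] [Fintype P] [DecidableEq P] [Fintype Q] [DecidableEq Q]
    [Fintype U] [DecidableEq U] (e : A ⊕ Q ≃ (A ⊕ P) ⊕ U) {c : ℂ} (hc : c ≠ 0)
    (F : Matrix A A ℂ) (H : Matrix A P ℂ) (L : Matrix P A ℂ) {C : Matrix Q Q ℂ}
    {B : Matrix P P ℂ} {D : Matrix U U ℂ} {R : Matrix Q P ℂ} {E : Matrix Q U ℂ}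
    {E' : Matrix U Q ℂ} (hRR : Rᵀ * R = c • 1) (hRE : Rᵀ * E = 0) (hER : E' * R = 0)
    (hEE : E' * E = 1) (hCR : C * R = R * B) (hCE : C * E = E * D) :
    ∃ T : Matrix (A ⊕ Q) (A ⊕ Q) ℂ, IsUnit T ∧
      T⁻¹ * Matrix.fromBlocks F (H * Rᵀ) (R * L) C * T =
        Matrix.reindex e.symm e.symm
          (Matrix.fromBlocks (Matrix.fromBlocks F (c • H) L B) 0 0 D) := by
  refine exists_isUnit_inv_mul_mul_eq_reindex e
    (T := Matrix.fromCols (Matrix.fromBlocks 1 0 0 R) (Matrix.fromRows 0 E))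
    (S := Matrix.fromRows (Matrix.fromBlocks 1 0 0 (c⁻¹ • Rᵀ)) (Matrix.fromCols 0 E')) ?_ ?_
  · rw [Matrix.fromRows_mul_fromCols, Matrix.fromBlocks_multiply,
      Matrix.fromBlocks_mul_fromRows, Matrix.fromCols_mul_fromBlocks,
      Matrix.fromCols_mul_fromRows]
    simp [hRR, hRE, hER, hEE, smul_smul, inv_mul_cancel₀ hc]
  · rw [Matrix.mul_fromCols, Matrix.fromCols_mul_fromBlocks, Matrix.fromBlocks_multiply,
      Matrix.fromBlocks_multiply, Matrix.fromBlocks_mul_fromRows]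
    simp [Matrix.mul_assoc, hRR, hRE, hCR, hCE, Matrix.fromRows_mul]

lemma ZMod.apply_natCast_val_castHom_of_periodic {α : Type*} {n m : ℕ} [NeZero n] [NeZero m]
    (h : m ∣ n) {g : ZMod n → α} (hg : Function.Periodic g (m : ZMod n)) (i : ZMod n) :
    g ((ZMod.castHom h (ZMod m) i).val : ℕ) = g i := by
  have hval : (ZMod.castHom h (ZMod m) i).val = i.val % m := by
    rw [ZMod.castHom_apply, ZMod.cast_eq_val, ZMod.val_natCast]
  have hi : i = ((i.val % m : ℕ) : ZMod n) + ((i.val / m : ℕ) : ZMod n) * (m : ZMod n) := by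
    rw [← Nat.cast_mul, ← Nat.cast_add, mul_comm, Nat.mod_add_div, ZMod.natCast_zmod_val]
  conv_rhs => rw [hi]
  rw [hval, hg.nat_mul]

lemma ZMod.card_castHom_fiber {n m c : ℕ} [NeZero n] [NeZero m] (h : m ∣ n) (hc : n = m * c)
    (v : ZMod m) :
    (Finset.univ.filter fun i : ZMod n => ZMod.castHom h (ZMod m) i = v).card = c := by
  have hsurj := ZMod.castHom_surjective h
  have hfib (w : ZMod m) :
      (Finset.univ.filter fun i : ZMod n => ZMod.castHom h (ZMod m) i = w).card =
        (Finset.univ.filter fun i : ZMod n => ZMod.castHom h (ZMod m) i = v).card :=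
    AddMonoidHom.card_fiber_eq_of_mem_range (ZMod.castHom h (ZMod m)).toAddMonoidHom
      (hsurj w) (hsurj v)
  have htot := Finset.card_eq_sum_card_fiberwise (s := (Finset.univ : Finset (ZMod n)))
    (t := Finset.univ) (f := ZMod.castHom h (ZMod m)) (by simp [Set.MapsTo])
  simp only [hfib, Finset.sum_const, Finset.card_univ, ZMod.card, smul_eq_mul] at htot
  exact Nat.eq_of_mul_eq_mul_left (NeZero.pos m) (htot.symm.trans hc)

/-- A unit frequency is orthogonal to every function that factors through `ZMod m`. -/
lemma ZMod.sum_castHom_mul_stdAddChar_eq_zero {n m : ℕ} [NeZero n] [NeZero m] (h : m ∣ n)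
    (hlt : m < n) (g : ZMod m → ℂ) {γ : ZMod n} (hγ : IsUnit γ) :
    ∑ i : ZMod n, g (ZMod.castHom h (ZMod m) i) * ZMod.stdAddChar (γ * i) = 0 := by
  have hne : ZMod.stdAddChar (γ * (m : ZMod n)) ≠ 1 := by
    intro h1
    rw [← AddChar.map_zero_eq_one (ZMod.stdAddChar (N := n))] at h1
    have h2 := (hγ.mul_right_eq_zero).1 (ZMod.injective_stdAddChar h1)
    exact Nat.not_dvd_of_pos_of_lt (NeZero.pos m) hlt ((ZMod.natCast_eq_zero_iff m n).1 h2)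
  have hshift : ∑ i : ZMod n, g (ZMod.castHom h (ZMod m) i) * ZMod.stdAddChar (γ * i) =
      ZMod.stdAddChar (γ * (m : ZMod n)) *
        ∑ i : ZMod n, g (ZMod.castHom h (ZMod m) i) * ZMod.stdAddChar (γ * i) := by
    conv_lhs => rw [← Equiv.sum_comp (Equiv.addRight (m : ZMod n))]
    rw [Finset.mul_sum]
    refine Finset.sum_congr rfl fun i _ => ?_
    rw [Equiv.coe_addRight, map_add, map_natCast, ZMod.natCast_self, add_zero, mul_add,
      AddChar.map_add_eq_mul]
    ring
  exact eq_zero_of_mul_eq_self_left hne hshift.symm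

lemma ZMod.exp_pow_val_eq_stdAddChar {n : ℕ} [NeZero n] (u : ZMod n) :
    Complex.exp (2 * (Real.pi : ℂ) * Complex.I / (n : ℂ)) ^ u.val = ZMod.stdAddChar u := by
  rw [ZMod.stdAddChar_apply, ZMod.toCircle_apply, ← Complex.exp_nat_mul]
  congr 1
  ring

/-- Indicator matrix of the reduction `ZMod n → ZMod m`. -/
noncomputable def ZMod.reductionMatrix {n m : ℕ} (h : m ∣ n) : Matrix (ZMod n) (ZMod m) ℂ :=
  Matrix.of fun i v => if ZMod.castHom h (ZMod m) i = v then 1 else 0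

/-- The columns of the Fourier matrix of `ZMod n` at unit frequencies. -/
noncomputable def ZMod.unitFourierMatrix (n : ℕ) [NeZero n] : Matrix (ZMod n) (ZMod n)ˣ ℂ :=
  Matrix.of fun i γ => ZMod.stdAddChar ((γ : ZMod n) * i)

/-- The left inverse of `ZMod.unitFourierMatrix`. -/
noncomputable def ZMod.unitFourierInvMatrix (n : ℕ) [NeZero n] : Matrix (ZMod n)ˣ (ZMod n) ℂ :=
  Matrix.of fun γ i => (n : ℂ)⁻¹ * ZMod.stdAddChar (-(γ : ZMod n) * i)

lemma ZMod.reductionMatrix_transpose_mul_self {n m c : ℕ} [NeZero n] [NeZero m] (h : m ∣ n)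
    (hc : n = m * c) :
    (ZMod.reductionMatrix h)ᵀ * ZMod.reductionMatrix h = (c : ℂ) • 1 := by
  ext v w
  simp only [Matrix.mul_apply, Matrix.transpose_apply, ZMod.reductionMatrix, Matrix.of_apply,
    Matrix.smul_apply, Matrix.one_apply, smul_eq_mul, mul_ite, mul_one, mul_zero]
  split_ifs with hvw
  · subst hvw
    rw [← ZMod.card_castHom_fiber h hc v, Finset.card_filter]
    push_cast
    exact Finset.sum_congr rfl fun i _ => by split_ifs <;> rfl
  · refine Finset.sum_eq_zero fun i _ => ?_
    split_ifs with h1 h2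
    · exact absurd (h2.symm.trans h1) hvw
    all_goals rfl

lemma ZMod.reductionMatrix_transpose_mul_unitFourierMatrix {n m : ℕ} [NeZero n] [NeZero m]
    (h : m ∣ n) (hlt : m < n) :
    (ZMod.reductionMatrix h)ᵀ * ZMod.unitFourierMatrix n = 0 := by
  ext v γ
  exact ZMod.sum_castHom_mul_stdAddChar_eq_zero h hlt (fun w => if w = v then 1 else 0) γ.isUnit

lemma ZMod.unitFourierInvMatrix_mul_reductionMatrix {n m : ℕ} [NeZero n] [NeZero m]
    (h : m ∣ n) (hlt : m < n) :
    ZMod.unitFourierInvMatrix n * ZMod.reductionMatrix h = 0 := by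
  ext γ v
  have h0 := ZMod.sum_castHom_mul_stdAddChar_eq_zero h hlt
    (fun w => (n : ℂ)⁻¹ * if w = v then 1 else 0) γ.isUnit.neg
  rw [Matrix.zero_apply, ← h0, Matrix.mul_apply]
  refine Finset.sum_congr rfl fun i _ => ?_
  simp only [ZMod.unitFourierInvMatrix, ZMod.reductionMatrix, Matrix.of_apply]
  ring

lemma ZMod.unitFourierInvMatrix_mul_unitFourierMatrix (n : ℕ) [NeZero n] :
    ZMod.unitFourierInvMatrix n * ZMod.unitFourierMatrix n = 1 := by
  ext γ δ
  have hsum := AddChar.sum_mulShift ((δ : ZMod n) - (γ : ZMod n)) (ZMod.isPrimitive_stdAddChar n)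
  have hn : (n : ℂ) ≠ 0 := NeZero.ne _
  have hterm (i : ZMod n) : (n : ℂ)⁻¹ * ZMod.stdAddChar (-(γ : ZMod n) * i) *
      ZMod.stdAddChar ((δ : ZMod n) * i) =
        (n : ℂ)⁻¹ * ZMod.stdAddChar (i * ((δ : ZMod n) - (γ : ZMod n))) := by
    rw [mul_assoc, ← AddChar.map_add_eq_mul]
    congr 2
    ring
  simp only [Matrix.mul_apply, ZMod.unitFourierInvMatrix, ZMod.unitFourierMatrix,
    Matrix.of_apply, hterm, ← Finset.mul_sum, hsum, Matrix.one_apply, sub_eq_zero, Units.val_inj,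
    eq_comm (a := (δ : (ZMod n)ˣ)), ZMod.card]
  split_ifs <;> simp [hn]

lemma ZMod.nonempty_equiv_sum_units_of_prime_pow {p N : ℕ} (hp : p.Prime) (hN : 1 ≤ N)
    [NeZero (p ^ N)] [NeZero (p ^ (N - 1))] :
    Nonempty (ZMod (p ^ N) ≃ ZMod (p ^ (N - 1)) ⊕ (ZMod (p ^ N))ˣ) := by
  refine Fintype.card_eq.1 ?_
  rw [Fintype.card_sum, ZMod.card, ZMod.card, ZMod.card_units_eq_totient,
    Nat.totient_prime_pow hp hN]
  obtain ⟨k, rfl⟩ := Nat.exists_eq_add_of_le hN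
  obtain ⟨q, hq⟩ := Nat.exists_eq_add_of_le hp.one_le
  simp only [hq, Nat.add_sub_cancel_left]
  ring

theorem equitable_decomposition_prime_power_step_similarity
    (p N f r : ℕ) (hp : p.Prime) (hN : 1 ≤ N)
    [NeZero (p ^ N)] [NeZero (p ^ (N - 1))]
    (M : Matrix (Fin f ⊕ (ZMod (p ^ N) × Fin r)) (Fin f ⊕ (ZMod (p ^ N) × Fin r)) ℂ)
    (Cblk : ZMod (p ^ N) → Matrix (Fin r) (Fin r) ℂ)
    (hC : ∀ (i j : ZMod (p ^ N)) (a b : Fin r),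
      M (Sum.inr (i, a)) (Sum.inr (j, b)) = Cblk (j - i) a b)
    (hHper : ∀ (x : Fin f) (i : ZMod (p ^ N)) (a : Fin r),
      M (Sum.inl x) (Sum.inr (i, a)) =
        M (Sum.inl x) (Sum.inr (i + ((p ^ (N - 1) : ℕ) : ZMod (p ^ N)), a)))
    (hLper : ∀ (x : Fin f) (i : ZMod (p ^ N)) (a : Fin r),
      M (Sum.inr (i, a)) (Sum.inl x) =
        M (Sum.inr (i + ((p ^ (N - 1) : ℕ) : ZMod (p ^ N)), a)) (Sum.inl x))
    (F : Matrix (Fin f) (Fin f) ℂ)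
    (hF : ∀ x y, F x y = M (Sum.inl x) (Sum.inl y))
    (H : Matrix (Fin f) (ZMod (p ^ (N - 1)) × Fin r) ℂ)
    (hH : ∀ x v a, H x (v, a) = M (Sum.inl x) (Sum.inr (((v.val : ℕ) : ZMod (p ^ N)), a)))
    (L : Matrix (ZMod (p ^ (N - 1)) × Fin r) (Fin f) ℂ)
    (hL : ∀ v a x, L (v, a) x = M (Sum.inr (((v.val : ℕ) : ZMod (p ^ N)), a)) (Sum.inl x))
    (B₀ : Matrix (ZMod (p ^ (N - 1)) × Fin r) (ZMod (p ^ (N - 1)) × Fin r) ℂ)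
    (hB₀ : ∀ v v' a b, B₀ (v, a) (v', b) =
      ∑ u ∈ Finset.univ.filter (fun u : ZMod (p ^ N) =>
          ZMod.castHom (pow_dvd_pow p (Nat.sub_le N 1)) (ZMod (p ^ (N - 1))) u = v' - v),
        Cblk u a b)
    (Mt : Matrix (Fin f ⊕ (ZMod (p ^ (N - 1)) × Fin r))
        (Fin f ⊕ (ZMod (p ^ (N - 1)) × Fin r)) ℂ)
    (hMt : Mt = Matrix.fromBlocks F ((p : ℂ) • H) L B₀)
    (ω : ℂ) (hω : ω = Complex.exp (2 * (Real.pi : ℂ) * Complex.I / ((p : ℂ) ^ N)))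
    (B : (ZMod (p ^ N))ˣ → Matrix (Fin r) (Fin r) ℂ)
    (hB : ∀ γ, B γ = ∑ m : ZMod (p ^ N), ω ^ (((γ : ZMod (p ^ N)) * m).val) • Cblk m)
    (D : Matrix ((ZMod (p ^ N))ˣ × Fin r) ((ZMod (p ^ N))ˣ × Fin r) ℂ)
    (hD : ∀ γ γ' a b, D (γ, a) (γ', b) = if γ = γ' then B γ a b else 0) :
    ∃ (e : (Fin f ⊕ (ZMod (p ^ N) × Fin r)) ≃
        ((Fin f ⊕ (ZMod (p ^ (N - 1)) × Fin r)) ⊕ ((ZMod (p ^ N))ˣ × Fin r)))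
      (T : Matrix (Fin f ⊕ (ZMod (p ^ N) × Fin r)) (Fin f ⊕ (ZMod (p ^ N) × Fin r)) ℂ),
      IsUnit T ∧
      T⁻¹ * M * T = Matrix.reindex e.symm e.symm (Matrix.fromBlocks Mt 0 0 D) := by
  have hdvd : p ^ (N - 1) ∣ p ^ N := pow_dvd_pow p (Nat.sub_le N 1)
  have hlt : p ^ (N - 1) < p ^ N := Nat.pow_lt_pow_right hp.one_lt (by omega)
  have hmul : p ^ N = p ^ (N - 1) * p := (pow_sub_one_mul (by omega) p).symm
  obtain ⟨e₀⟩ := ZMod.nonempty_equiv_sum_units_of_prime_pow hp hN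
  let e : Fin f ⊕ (ZMod (p ^ N) × Fin r) ≃
      (Fin f ⊕ (ZMod (p ^ (N - 1)) × Fin r)) ⊕ ((ZMod (p ^ N))ˣ × Fin r) :=
    ((Equiv.refl _).sumCongr ((e₀.prodCongr (Equiv.refl _)).trans
      (Equiv.sumProdDistrib _ _ _))).trans (Equiv.sumAssoc _ _ _).symm
  let R := ZMod.reductionMatrix hdvd ⊗ₖ (1 : Matrix (Fin r) (Fin r) ℂ)
  let E := ZMod.unitFourierMatrix (p ^ N) ⊗ₖ (1 : Matrix (Fin r) (Fin r) ℂ)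
  let E' := ZMod.unitFourierInvMatrix (p ^ N) ⊗ₖ (1 : Matrix (Fin r) (Fin r) ℂ)
  let C : Matrix (ZMod (p ^ N) × Fin r) (ZMod (p ^ N) × Fin r) ℂ :=
    Matrix.of fun i j => Cblk (j.1 - i.1) i.2 j.2
  have hRR : Rᵀ * R = (p : ℂ) • 1 := by
    rw [← Matrix.kroneckerMap_transpose, ← Matrix.mul_kronecker_mul,
      ZMod.reductionMatrix_transpose_mul_self hdvd hmul, Matrix.smul_kronecker]
    simp
  have hRE : Rᵀ * E = 0 := by
    rw [← Matrix.kroneckerMap_transpose, ← Matrix.mul_kronecker_mul,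
      ZMod.reductionMatrix_transpose_mul_unitFourierMatrix hdvd hlt, Matrix.zero_kronecker]
  have hER : E' * R = 0 := by
    rw [← Matrix.mul_kronecker_mul,
      ZMod.unitFourierInvMatrix_mul_reductionMatrix hdvd hlt, Matrix.zero_kronecker]
  have hEE : E' * E = 1 := by
    rw [← Matrix.mul_kronecker_mul, ZMod.unitFourierInvMatrix_mul_unitFourierMatrix,
      Matrix.one_mul, Matrix.one_kronecker_one]
  have hCR : C * R = R * B₀ := by
    ext ⟨i, a⟩ ⟨v, b⟩
    simp only [Matrix.mul_apply, C, R, Fintype.sum_prod_type, Matrix.kroneckerMap_apply,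
      ZMod.reductionMatrix, Matrix.of_apply, Matrix.one_apply, hB₀, mul_ite, ite_mul, mul_one,
      mul_zero, one_mul, zero_mul, Finset.sum_ite_eq, Finset.sum_ite_eq', Finset.mem_univ, if_true,
      Finset.sum_filter]
    rw [← Equiv.sum_comp (Equiv.addRight i)]
    simp [eq_sub_iff_add_eq, -ZMod.castHom_apply]
  have hω_pow (u : ZMod (p ^ N)) : ω ^ u.val = ZMod.stdAddChar u := by
    rw [hω, ← ZMod.exp_pow_val_eq_stdAddChar, Nat.cast_pow]
  have hCE : C * E = E * D := by
    ext ⟨i, a⟩ ⟨γ, b⟩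
    simp only [Matrix.mul_apply, C, E, Fintype.sum_prod_type, Matrix.kroneckerMap_apply,
      ZMod.unitFourierMatrix, Matrix.of_apply, Matrix.one_apply, hD, hB, hω_pow, mul_ite, ite_mul,
      mul_one, mul_zero, zero_mul, Finset.sum_ite_eq', Finset.mem_univ, if_true, Matrix.sum_apply,
      Matrix.smul_apply, smul_eq_mul]
    rw [Finset.sum_comm (s := (Finset.univ : Finset (ZMod (p ^ N))ˣ))]
    simp only [Finset.sum_ite_eq, Finset.sum_ite_eq', Finset.mem_univ, if_true, Finset.mul_sum]
    rw [← Equiv.sum_comp (Equiv.addRight i)]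
    refine Finset.sum_congr rfl fun j _ => ?_
    rw [Equiv.coe_addRight, add_sub_cancel_right, mul_add, AddChar.map_add_eq_mul]
    ring
  have hM : M = Matrix.fromBlocks F (H * Rᵀ) (R * L) C := by
    ext (x | ⟨i, a⟩) (y | ⟨j, b⟩)
    · simp [hF]
    · simpa [Matrix.mul_apply, R, Fintype.sum_prod_type, ZMod.reductionMatrix, Matrix.one_apply,
        hH, -ZMod.castHom_apply] using (ZMod.apply_natCast_val_castHom_of_periodic hdvd
          (g := fun k => M (Sum.inl x) (Sum.inr (k, b))) (fun k => (hHper x k b).symm) j).symm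
    · simpa [Matrix.mul_apply, R, Fintype.sum_prod_type, ZMod.reductionMatrix, Matrix.one_apply,
        hL, -ZMod.castHom_apply] using (ZMod.apply_natCast_val_castHom_of_periodic hdvd
          (g := fun k => M (Sum.inr (k, a)) (Sum.inl y)) (fun k => (hLper y k a).symm) i).symm
    · simp [hC, C]
  refine ⟨e, ?_⟩
  rw [hM, hMt]
  exact exists_isUnit_inv_mul_fromBlocks_mul_eq_reindex e (Nat.cast_ne_zero.2 hp.ne_zero)
    F H L hRR hRE hER hEE hCR hCE
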